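/- The angles of any plane graph that is generically rigid in the plane can be labelled 'big' and 'small' so that the labelling is a CPT-labelling satisfying the generalized Laman property. -/

import Mathlib

/-! ## Combinatorial plane graphs via rotation systems -/

/-- The permutation of darts of a simple graph reversing each dart. -/
def dartSymmPerm {V : Type} (G : SimpleGraph V) : Equiv.Perm G.Dart where
  toFun := SimpleGraph.Dart.symm
  invFun := SimpleGraph.Dart.symm
  left_inv d := SimpleGraph.Dart.symm_symm d
  right_inv d := SimpleGraph.Dart.symm_symm d

/-- The setoid on `α` whose classes are the cycles (orbits) of a permutation `σ`. -/
def faceSetoid {α : Type} (σ : Equiv.Perm α) : Setoid α :=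
  ⟨σ.SameCycle, ⟨fun x => Equiv.Perm.SameCycle.refl σ x,
    fun h => h.symm, fun h h' => h.trans h'⟩⟩

/-- A (topological, non-crossing) embedding of a connected graph `G` in the plane, encoded
combinatorially: a rotation system (the counterclockwise cyclic order of the darts around
each vertex), which is planar in the sense of Euler's formula (the number of orbits of the
face permutation `rot * symm` is the number of faces), together with a distinguished
outer (unbounded) face.  A *plane graph* is a graph `G` together with such a structure. -/
structure PlaneEmb {V : Type} (G : SimpleGraph V) where
  rot : Equiv.Perm G.Dart
  rot_fst : ∀ d : G.Dart, (rot d).fst = d.fst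
  rot_vertex : ∀ d d' : G.Dart, d.fst = d'.fst → ∃ n : ℕ, (rot ^ n) d = d'
  connected : G.Connected
  outer : Quotient (faceSetoid (rot * dartSymmPerm G))
  euler : Nat.card V + Nat.card (Quotient (faceSetoid (rot * dartSymmPerm G)))
      = Nat.card G.edgeSet + 2

namespace PlaneEmb

variable {V : Type} {G : SimpleGraph V}

/-- The faces of a plane graph: orbits of the face permutation. -/
abbrev Face (E : PlaneEmb G) : Type := Quotient (faceSetoid (E.rot * dartSymmPerm G))

/-- The face having the dart `d` on its contour. -/
def dartFace (E : PlaneEmb G) (d : G.Dart) : E.Face :=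
  Quotient.mk (faceSetoid (E.rot * dartSymmPerm G)) d

/-- Each dart `d` determines an *angle* of the plane graph, namely the angle at the vertex
`d.fst` between the edges of `d` and `rot d`; `E.angleFace d` is the face this angle lies in. -/
def angleFace (E : PlaneEmb G) (d : G.Dart) : E.Face :=
  Quotient.mk (faceSetoid (E.rot * dartSymmPerm G)) d.symm

end PlaneEmb

/-- A vertex is *pointed* (w.r.t. an assignment `big` of which angles are labelled big)
if some angle at it is labelled big. -/
def PointedVx {V : Type} {G : SimpleGraph V} (big : G.Dart → Prop) (v : V) : Prop :=
  ∃ d : G.Dart, big d ∧ d.fst = v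

/-- A *combinatorial pseudo-triangulation labelling* (CPT-labelling): every bounded face has
exactly three small angles, all angles of the unbounded face are big, and no vertex is
incident to more than one big angle. -/
structure IsCPTLabelling {V : Type} {G : SimpleGraph V} (E : PlaneEmb G)
    (big : G.Dart → Prop) : Prop where
  bounded_small : ∀ F : E.Face, F ≠ E.outer →
    Nat.card {d : G.Dart | E.angleFace d = F ∧ ¬ big d} = 3
  outer_big : ∀ d : G.Dart, E.angleFace d = E.outer → big d
  one_big : ∀ d d' : G.Dart, big d → big d' → d.fst = d'.fst → d = d'

/-- The generalized Laman property of a combinatorial pseudo-triangulation: any `x` non-pointed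
plus `y` pointed vertices, with `x + y ≥ 2`, induce at most `3x + 2y - 3` edges. -/
def GenLaman {V : Type} (G : SimpleGraph V) (big : G.Dart → Prop) : Prop :=
  ∀ S : Set V, 2 ≤ Nat.card S →
    (Nat.card ((G.induce S).edgeSet) : ℤ) ≤
      3 * Nat.card {v ∈ S | ¬ PointedVx big v} + 2 * Nat.card {v ∈ S | PointedVx big v} - 3

/-! ## Rigidity -/

/-- Dot product in the plane. -/
def dot2 (u w : ℝ × ℝ) : ℝ := u.1 * w.1 + u.2 * w.2

/-- Rotation by 90 degrees. -/
def rot90 (u : ℝ × ℝ) : ℝ × ℝ := (-u.2, u.1)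

/-- `q` is an infinitesimal motion of the bar-and-joint framework `(G, p)`. -/
def IsInfMotion {V : Type} (G : SimpleGraph V) (p q : V → ℝ × ℝ) : Prop :=
  ∀ u v : V, G.Adj u v → dot2 (p u - p v) (q u - q v) = 0

/-- Trivial infinitesimal motions: those coming from rigid motions of the plane
(infinitesimal rotations and translations). -/
def IsTrivialMotion {V : Type} (p q : V → ℝ × ℝ) : Prop :=
  ∃ (a : ℝ) (t : ℝ × ℝ), ∀ v : V, q v = a • rot90 (p v) + t

/-- The framework `(G, p)` is infinitesimally rigid: it has no non-trivial infinitesimal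
motions. -/
def InfRigid {V : Type} (G : SimpleGraph V) (p : V → ℝ × ℝ) : Prop :=
  ∀ q : V → ℝ × ℝ, IsInfMotion G p q → IsTrivialMotion p q

/-- A configuration of points is *generic* if its coordinates are algebraically
independent over `ℚ`. -/
def GenericConf {V : Type} (p : V → ℝ × ℝ) : Prop :=
  AlgebraicIndependent ℚ (fun x : V ⊕ V => Sum.elim (fun v => (p v).1) (fun v => (p v).2) x)

/-- A graph is *generically rigid in the plane* if every generic framework on it has no
non-trivial infinitesimal motions. -/
def GenRigid {V : Type} (G : SimpleGraph V) : Prop :=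
  ∀ p : V → ℝ × ℝ, GenericConf p → InfRigid G p

/-- A graph is *isostatic* (generically minimally rigid) if it is generically rigid and
removing any edge destroys generic rigidity. -/
def Isostatic {V : Type} (G : SimpleGraph V) : Prop :=
  GenRigid G ∧ ∀ e ∈ G.edgeSet, ¬ GenRigid (G.deleteEdges {e})

/-- Laman's condition: exactly `2n - 3` edges, and every `k ≥ 2` vertices span at most
`2k - 3` edges. -/
def LamanGraph {V : Type} (L : SimpleGraph V) : Prop :=
  (Nat.card L.edgeSet : ℤ) = 2 * Nat.card V - 3 ∧
  ∀ S : Set V, 2 ≤ Nat.card S →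
    (Nat.card ((L.induce S).edgeSet) : ℤ) ≤ 2 * Nat.card S - 3

/-! ## Geometry: straight-line drawings, angles, stretching -/

/-- The counterclockwise angle from the direction `u` to the direction `w`,
normalized to lie in `(0, 2π]` (a full turn for `w` pointing in the direction of `u`). -/
noncomputable def ccwAngle (u w : ℝ × ℝ) : ℝ :=
  if 0 < Complex.arg ((⟨w.1, w.2⟩ : ℂ) / (⟨u.1, u.2⟩ : ℂ)) then
    Complex.arg ((⟨w.1, w.2⟩ : ℂ) / (⟨u.1, u.2⟩ : ℂ))
  else Complex.arg ((⟨w.1, w.2⟩ : ℂ) / (⟨u.1, u.2⟩ : ℂ)) + 2 * Real.pi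

/-- The (counterclockwise) geometric angle, in the straight-line drawing `p`, of the angle of
the dart `d`, i.e. the angle at `d.fst` between the edge of `d` and the edge of `rot d`. -/
noncomputable def dartAngle {V : Type} {G : SimpleGraph V} (E : PlaneEmb G)
    (p : V → ℝ × ℝ) (d : G.Dart) : ℝ :=
  ccwAngle (p d.snd - p d.fst) (p (E.rot d).snd - p (E.rot d).fst)

/-- A straight-line drawing is non-crossing: distinct edges meet only in common endpoints,
and no vertex lies on an edge not incident to it. -/
def NonCrossing {V : Type} (G : SimpleGraph V) (p : V → ℝ × ℝ) : Prop :=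
  (∀ a b c d : V, G.Adj a b → G.Adj c d → ({a, b} : Set V) ≠ {c, d} →
    segment ℝ (p a) (p b) ∩ segment ℝ (p c) (p d) ⊆ p '' ({a, b} ∩ {c, d} : Set V)) ∧
  (∀ x a b : V, G.Adj a b → x ≠ a → x ≠ b → p x ∉ segment ℝ (p a) (p b))

/-- The points of the drawing are in general position: no three of them are collinear. -/
def GenPos {V : Type} (p : V → ℝ × ℝ) : Prop :=
  ∀ u v w : V, u ≠ v → u ≠ w → v ≠ w → ¬ Collinear ℝ ({p u, p v, p w} : Set (ℝ × ℝ))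

/-- The straight-line drawing `p` realizes the plane graph `(G, E)`: it is injective and
non-crossing, and around every (non-isolated) vertex the counterclockwise angles between
rotation-consecutive darts sum to `2π`, so the drawing induces the given rotation system. -/
def RealizesEmb {V : Type} [Fintype V] [DecidableEq V] (G : SimpleGraph V)
    [DecidableRel G.Adj] (E : PlaneEmb G) (p : V → ℝ × ℝ) : Prop :=
  Function.Injective p ∧ NonCrossing G p ∧
  ∀ v : V, (∃ d : G.Dart, d.fst = v) →
    ∑ d ∈ Finset.univ.filter (fun d : G.Dart => d.fst = v), dartAngle E p d = 2 * Real.pi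

/-- The drawing `p` *stretches* the angle labelling `big` of the plane graph `(G, E)`:
it realizes the embedding, has its (finitely many) vertices in general position, and every
angle labelled big is reflex (> 180°) while every angle labelled small is convex (< 180°).
If `big` is a CPT-labelling this makes `p` a pseudo-triangulation of its vertex set:
every bounded face is a pseudo-triangle and the convex hull edges are present. -/
def Stretches {V : Type} [Fintype V] [DecidableEq V] (G : SimpleGraph V)
    [DecidableRel G.Adj] (E : PlaneEmb G) (big : G.Dart → Prop) (p : V → ℝ × ℝ) : Prop :=
  RealizesEmb G E p ∧ GenPos p ∧
  ∀ d : G.Dart, (big d → Real.pi < dartAngle E p d) ∧ (¬ big d → dartAngle E p d < Real.pi)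

/-- The drawing `p` makes the plane graph `(G, E)` a pseudo-triangulation of its vertex set
(with the given embedding): for the labelling of the angles of the drawing as big (reflex)
or small (convex), every bounded face has exactly three small angles (is a pseudo-triangle)
and all outer angles are big (so the convex hull edges are present). -/
def StretchesToPT {V : Type} [Fintype V] [DecidableEq V] (G : SimpleGraph V)
    [DecidableRel G.Adj] (E : PlaneEmb G) (p : V → ℝ × ℝ) : Prop :=
  ∃ big : G.Dart → Prop, IsCPTLabelling E big ∧ Stretches G E big p

/-- A vertex `v` of a geometric straight-line drawing is *pointed* if all the edges at `v`
lie in a closed half-plane supported at `v`. -/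
def GeoPointed {V : Type} (G : SimpleGraph V) (p : V → ℝ × ℝ) (v : V) : Prop :=
  ∃ u : ℝ × ℝ, u ≠ 0 ∧ ∀ w : V, G.Adj v w → 0 ≤ dot2 u (p w - p v)

/-! ## Subgraphs, outer face, corners -/

/-- One step of dual connectivity avoiding the edge set `A`: the faces `F`, `F'` are the two
sides of some edge of `G` not belonging to `A`. -/
def FaceStep {V : Type} {G : SimpleGraph V} (E : PlaneEmb G) (A : Set (Sym2 V)) :
    E.Face → E.Face → Prop :=
  fun F F' => ∃ d : G.Dart, E.dartFace d = F ∧ E.dartFace d.symm = F' ∧ d.edge ∉ A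

/-- The face `F` of `G` is contained in the outer (unbounded) face of the plane subgraph of
`G` with edge set `A`: `F` can reach the outer face of `G` in the dual graph without
crossing the edges of `A`. -/
def InOuterOf {V : Type} {G : SimpleGraph V} (E : PlaneEmb G) (A : Set (Sym2 V))
    (F : E.Face) : Prop :=
  Relation.ReflTransGen (FaceStep E A) F E.outer

/-- `v` is a *corner* of the subgraph `H` of the combinatorial pseudo-triangulation
`(G, E, big)`: either `v` is pointed in `G` and its big angle is contained in the
outer face of `H`, or `v` is non-pointed in `G` and two consecutive (small) angles at `v`
are contained in the outer face of `H`. -/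
def IsCPTCorner {V : Type} {G : SimpleGraph V} (E : PlaneEmb G) (big : G.Dart → Prop)
    (H : G.Subgraph) (v : V) : Prop :=
  (v ∈ H.verts ∧ ∃ d : G.Dart, big d ∧ d.fst = v ∧ InOuterOf E H.edgeSet (E.angleFace d)) ∨
  (v ∈ H.verts ∧ ¬ PointedVx big v ∧ ∃ d : G.Dart, d.fst = v ∧
    InOuterOf E H.edgeSet (E.angleFace d) ∧ InOuterOf E H.edgeSet (E.angleFace (E.rot d)) ∧
    (E.rot d).edge ∉ H.edgeSet)

/-- A plane graph has *non-degenerate faces* if no edge appears twice on the contour cycle of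
a face, i.e. the edges incident to every face form a simple closed cycle. -/
def NonDegenerateFaces {V : Type} {G : SimpleGraph V} (E : PlaneEmb G) : Prop :=
  ∀ d : G.Dart, ¬ (E.rot * dartSymmPerm G).SameCycle d d.symm



structure RankAx {α : Type} [DecidableEq α] (r : Finset α → ℤ) : Prop where
  empty : r ∅ = 0
  mono : ∀ A B, A ⊆ B → r A ≤ r B
  submod : ∀ A B, r (A ∪ B) + r (A ∩ B) ≤ r A + r B
  unit : ∀ e, r {e} ≤ 1

theorem RankAx.contract {α : Type} [DecidableEq α] {r : Finset α → ℤ} (h : RankAx r) (e : α)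
    (he : r {e} = 1) : RankAx (fun A => r (insert e A) - 1) where
  empty := by simp [he]
  mono A B hAB := by
    have := h.mono _ _ (Finset.insert_subset_insert e hAB)
    simpa using this
  submod A B := by
    have := h.submod (insert e A) (insert e B)
    have h1 : insert e A ∪ insert e B = insert e (A ∪ B) := by ext; simp only [Finset.mem_union, Finset.mem_insert]; tauto
    have h2 : insert e A ∩ insert e B = insert e (A ∩ B) := by
      ext; simp only [Finset.mem_inter, Finset.mem_insert]; tauto
    rw [h1, h2] at this
    linarith
  unit f := by
    have := h.submod {e} {f}
    have h1 : ({e} ∪ {f} : Finset α) = insert e {f} := by ext; simp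
    have h2 := h.mono ∅ ({e} ∩ {f}) (by simp)
    have h3 := h.unit f
    rw [h1] at this
    rw [h.empty] at h2
    linarith

theorem matroid_inter {α : Type} [DecidableEq α] (E : Finset α) :
    ∀ (r1 r2 : Finset α → ℤ) (_ : RankAx r1) (_ : RankAx r2) (k : ℕ)
      (_ : ∀ A ⊆ E, (k : ℤ) ≤ r1 A + r2 (E \ A)),
      ∃ I ⊆ E, I.card = k ∧ r1 I = k ∧ r2 I = k := by
  induction E using Finset.induction_on with
  | empty =>
    intro r1 r2 h1 h2 k hk
    have := hk ∅ (by simp)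
    simp [h1.empty, h2.empty] at this
    subst this
    exact ⟨∅, by simp, by simp, by simp [h1.empty], by simp [h2.empty]⟩
  | insert e E he ih =>
    intro r1 r2 h1 h2 k hk
    by_cases hdel : ∀ A ⊆ E, (k : ℤ) ≤ r1 A + r2 (E \ A)
    · obtain ⟨I, hI, h⟩ := ih r1 r2 h1 h2 k hdel
      exact ⟨I, hI.trans (Finset.subset_insert _ _), h⟩
    push Not at hdel
    obtain ⟨A, hA, hAk⟩ := hdel
    have heA : e ∉ A := fun h => he (hA h)
    have e1 : insert e E \ A = insert e (E \ A) := by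
      ext x
      simp only [Finset.mem_sdiff, Finset.mem_insert]
      by_cases hx : x = e
      · subst hx; tauto
      · tauto
    have e2 : insert e E \ insert e A = E \ A := by
      ext x
      simp only [Finset.mem_sdiff, Finset.mem_insert]
      by_cases hx : x = e
      · subst hx; tauto
      · tauto
    have hA1 := hk A (hA.trans (Finset.subset_insert _ _))
    have hA2 := hk (insert e A) (Finset.insert_subset_insert e hA)
    rw [e1] at hA1
    rw [e2] at hA2
    have s1 := h1.submod {e} A
    have s2 := h2.submod {e} (E \ A)
    have m1 := h1.mono ∅ ({e} ∩ A) (by simp)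
    have m2 := h2.mono ∅ ({e} ∩ (E \ A)) (by simp)
    rw [h1.empty] at m1
    rw [h2.empty] at m2
    rw [← Finset.insert_eq] at s1 s2
    have u1 := h1.unit e
    have u2 := h2.unit e
    have v1 : r1 {e} = 1 := by linarith
    have v2 : r2 {e} = 1 := by linarith
    have hk1 : 1 ≤ k := by
      by_contra hk0
      have : k = 0 := by omega
      subst this
      have a1 := h1.mono ∅ A (by simp)
      have a2 := h2.mono ∅ (E \ A) (by simp)
      rw [h1.empty] at a1
      rw [h2.empty] at a2
      push_cast at hAk
      linarith
    obtain ⟨I, hI, hc, hi1, hi2⟩ := ih _ _ (h1.contract e v1) (h2.contract e v2) (k - 1) (by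
      intro B hB
      by_contra hcon
      push_cast [hk1] at hcon
      have t1 := h1.submod A (insert e B)
      have t2 := h2.submod (E \ A) (insert e (E \ B))
      have heB : e ∉ B := fun h => he (hB h)
      have q1 : A ∪ insert e B = insert e (A ∪ B) := by
        ext; simp only [Finset.mem_union, Finset.mem_insert]; tauto
      have q2 : A ∩ insert e B = A ∩ B := by
        ext x; simp only [Finset.mem_inter, Finset.mem_insert]; constructor
        · rintro ⟨h, rfl | h'⟩ <;> tauto
        · tauto
      have q3 : E \ A ∪ insert e (E \ B) = insert e E \ (A ∩ B) := by
        ext x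
        simp only [Finset.mem_union, Finset.mem_sdiff, Finset.mem_insert, Finset.mem_inter]
        by_cases hx : x = e
        · subst hx; tauto
        · tauto
      have q4 : (E \ A) ∩ insert e (E \ B) = insert e E \ insert e (A ∪ B) := by
        ext x
        simp only [Finset.mem_union, Finset.mem_sdiff, Finset.mem_insert, Finset.mem_inter]
        by_cases hx : x = e
        · subst hx; tauto
        · tauto
      rw [q1, q2] at t1
      rw [q3, q4] at t2
      have w1 := hk (A ∩ B) (fun x hx => Finset.mem_insert_of_mem (hA (Finset.mem_inter.1 hx).1))
      have w2 := hk (insert e (A ∪ B)) (Finset.insert_subset_insert e (Finset.union_subset hA hB))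
      linarith)
    have heI : e ∉ I := fun h => he (hI h)
    refine ⟨insert e I, Finset.insert_subset_insert e hI, ?_, ?_, ?_⟩
    · rw [Finset.card_insert_of_notMem heI]; omega
    · push_cast [hk1] at hi1; linarith
    · push_cast [hk1] at hi2; linarith

theorem rankAx_span {α : Type} [DecidableEq α] {M : Type*} [AddCommGroup M] [Module ℝ M]
    [FiniteDimensional ℝ M] (φ : α → M) :
    RankAx (fun A : Finset α => (Module.finrank ℝ (Submodule.span ℝ (φ '' (A : Set α))) : ℤ)) where
  empty := by simp
  mono A B h := by
    simp only [Nat.cast_le]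
    exact Submodule.finrank_mono (Submodule.span_mono (Set.image_mono (by exact_mod_cast h)))
  submod A B := by
    have h1 := Submodule.finrank_sup_add_finrank_inf_eq (Submodule.span ℝ (φ '' (A : Set α)))
      (Submodule.span ℝ (φ '' (B : Set α)))
    have h2 : Submodule.span ℝ (φ '' ((A ∩ B : Finset α) : Set α)) ≤
      Submodule.span ℝ (φ '' (A : Set α)) ⊓ Submodule.span ℝ (φ '' (B : Set α)) := by
      apply le_inf <;> apply Submodule.span_mono <;> apply Set.image_mono <;> simp
    have h3 := Submodule.finrank_mono h2
    rw [← Submodule.span_union, ← Set.image_union, ← Finset.coe_union] at h1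
    omega
  unit e := by
    have := finrank_span_le_card (R := ℝ) ({φ e} : Set M)
    have h2 : φ '' (({e} : Finset α) : Set α) = {φ e} := by
      rw [Finset.coe_singleton, Set.image_singleton]
    rw [h2]
    simp only [Set.toFinset_singleton, Finset.card_singleton] at this
    exact_mod_cast this

theorem coann_rank {α : Type} [DecidableEq α] {W : Type*} [AddCommGroup W] [Module ℝ W]
    [FiniteDimensional ℝ W] (φ : α → Module.Dual ℝ W) (A : Finset α) (K : Submodule ℝ W)
    (hK : ∀ w, w ∈ K ↔ ∀ d ∈ A, φ d w = 0) :
    Module.finrank ℝ (Submodule.span ℝ (φ '' (A : Set α))) + Module.finrank ℝ K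
      = Module.finrank ℝ W := by
  have h := Subspace.finrank_add_finrank_dualCoannihilator_eq
    (Submodule.span ℝ (φ '' (A : Set α)))
  have : K = (Submodule.span ℝ (φ '' (A : Set α))).dualCoannihilator := by
    ext w
    rw [hK, Submodule.mem_dualCoannihilator]
    constructor
    · intro hw f hf
      induction hf using Submodule.span_induction with
      | mem x hx => obtain ⟨d, hd, rfl⟩ := hx; exact hw d hd
      | zero => simp
      | add x y _ _ hx hy => simp [hx, hy]
      | smul a x _ hx => simp [hx]
    · intro hw d hd
      exact hw _ (Submodule.subset_span ⟨d, hd, rfl⟩)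
  rw [this]; exact h

/-- the submodule killed by a finite family of functionals -/
def killed {α : Type} {W : Type*} [AddCommGroup W] [Module ℝ W] (φ : α → Module.Dual ℝ W)
    (A : Set α) : Submodule ℝ W where
  carrier := {w | ∀ d ∈ A, φ d w = 0}
  zero_mem' := by simp
  add_mem' := by intro a b ha hb d hd; simp [ha d hd, hb d hd]
  smul_mem' := by intro c a ha d hd; simp [ha d hd]

/-- linear matroid intersection -/
theorem linear_inter {α : Type} [DecidableEq α] [Fintype α] {W : Type*} [AddCommGroup W]
    [Module ℝ W] [FiniteDimensional ℝ W] (φ ψ : α → Module.Dual ℝ W)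
    (h : ∀ A : Finset α, ∀ w, (∀ d ∈ A, φ d w = 0) → (∀ d ∉ A, ψ d w = 0) → w = 0) :
    ∃ I : Finset α, I.card = Module.finrank ℝ W ∧ (∀ w, (∀ d ∈ I, φ d w = 0) → w = 0) ∧
      (∀ w, (∀ d ∈ I, ψ d w = 0) → w = 0) := by
  obtain ⟨I, -, hc, h1, h2⟩ := matroid_inter Finset.univ _ _ (rankAx_span φ) (rankAx_span ψ)
    (Module.finrank ℝ W) (by
      intro A _
      have a1 := coann_rank φ A (killed φ A) (fun w => Iff.rfl)
      have a2 := coann_rank ψ (Finset.univ \ A) (killed ψ (Finset.univ \ A : Finset α))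
        (fun w => Iff.rfl)
      have a3 := Submodule.finrank_sup_add_finrank_inf_eq (killed φ (A : Set α))
        (killed ψ ((Finset.univ \ A : Finset α) : Set α))
      have a4 : killed φ (A : Set α) ⊓ killed ψ ((Finset.univ \ A : Finset α) : Set α) = ⊥ := by
        rw [eq_bot_iff]
        rintro w ⟨hw1, hw2⟩
        exact h A w hw1 (fun d hd => hw2 d (by simpa using hd))
      have a5 := Submodule.finrank_le (killed φ (A : Set α) ⊔
        killed ψ ((Finset.univ \ A : Finset α) : Set α))
      rw [a4, finrank_bot] at a3
      omega)
  refine ⟨I, hc, ?_, ?_⟩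
  · have a1 := coann_rank φ I (killed φ I) (fun w => Iff.rfl)
    have : Module.finrank ℝ (killed φ (I : Set α)) = 0 := by omega
    rw [Submodule.finrank_eq_zero] at this
    intro w hw
    have hw' : w ∈ killed φ (I : Set α) := hw
    rwa [this] at hw'
  · have a1 := coann_rank ψ I (killed ψ I) (fun w => Iff.rfl)
    have : Module.finrank ℝ (killed ψ (I : Set α)) = 0 := by omega
    rw [Submodule.finrank_eq_zero] at this
    intro w hw
    have hw' : w ∈ killed ψ (I : Set α) := hw
    rwa [this] at hw'

theorem matching_lemma {D C : Type} [Fintype D] [Fintype C] [DecidableEq C]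
    (M : Matrix D C ℝ) (X : Finset C)
    (h : ∀ x : C → ℝ, M.mulVec x = 0 → (∀ c ∈ X, x c = 0) → x = 0)
    (hc : Fintype.card D + X.card = Fintype.card C) :
    ∃ τ : D ≃ {c // c ∉ X}, ∀ d, M d (τ d) ≠ 0 := by
  classical
  have hcard : Fintype.card D = Fintype.card {c // c ∉ X} := by
    rw [Fintype.card_subtype_compl]
    simp
    omega
  let σ : D ≃ {c // c ∉ X} := Fintype.equivOfCardEq hcard
  let N : Matrix D D ℝ := fun d d' => M d (σ d')
  have hdet : N.det ≠ 0 := by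
    intro h0
    obtain ⟨v, hv, hNv⟩ := Matrix.exists_mulVec_eq_zero_iff.2 h0
    apply hv
    let x : C → ℝ := fun c => if hc : c ∉ X then v (σ.symm ⟨c, hc⟩) else 0
    have hx : x = 0 := by
      apply h
      · ext d
        have := congrFun hNv d
        simp only [Matrix.mulVec, dotProduct, Pi.zero_apply] at this ⊢
        rw [← this]
        rw [← Equiv.sum_comp σ.symm]
        simp only [N, Equiv.apply_symm_apply]
        have key : ∀ c : {c // c ∉ X}, v (σ.symm c) = x c := by
          intro c
          simp only [x, c.2, not_false_eq_true, dite_true]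
        simp only [key]
        rw [← Finset.sum_subtype (Finset.univ.filter (fun c => c ∉ X)) (p := fun c => c ∉ X)
          (by simp) (fun c => M d c * x c), Finset.sum_filter]
        apply Finset.sum_congr rfl
        intro c _
        by_cases hc : c ∈ X
        · simp [x, hc]
        · simp [hc]
      · intro c hc
        simp [x, hc]
    ext d
    have := congrFun hx (σ d)
    simpa [x, (σ d).2] using this
  rw [Matrix.det_apply] at hdet
  obtain ⟨π, -, hπ⟩ := Finset.exists_ne_zero_of_sum_ne_zero hdet
  have hp : ∏ i, N (π i) i ≠ 0 := fun h => hπ (by simp [h])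
  refine ⟨π.symm.trans σ, fun d => ?_⟩
  have := Finset.prod_ne_zero_iff.1 hp (π.symm d) (Finset.mem_univ _)
  simpa [N] using this

theorem exists_generic (V : Type) [Fintype V] : ∃ p : V → ℝ × ℝ, GenericConf p := by
  obtain ⟨ι, x, hx⟩ := exists_isTranscendenceBasis' ℚ ℝ
  have hR : Cardinal.aleph0 < Cardinal.mk ℝ := by
    rw [Cardinal.mk_real]; exact Cardinal.aleph0_lt_continuum
  have htr : Algebra.Transcendental ℚ ℝ := by
    rw [Algebra.transcendental_iff_not_isAlgebraic]
    intro h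
    have := Algebra.IsAlgebraic.cardinalMk_le_max ℚ ℝ
    simp at this
    exact absurd hR (not_lt.2 this)
  have hι : Nonempty ι := hx.nonempty_iff_transcendental.2 htr
  have hinf : Infinite ι := by
    by_contra hfin
    rw [not_infinite_iff_finite] at hfin
    have := hx.lift_cardinalMk_eq_max_lift
    have h2 : Cardinal.mk ι ≤ Cardinal.aleph0 := (Cardinal.lt_aleph0_of_finite ι).le
    simp [h2] at this
    exact absurd this hR.ne'
  obtain ⟨f⟩ : Nonempty ((V ⊕ V) ↪ ι) := by
    classical
    exact ⟨(Fintype.equivFin (V ⊕ V)).toEmbedding.trans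
      (Fin.valEmbedding.trans (Infinite.natEmbedding ι))⟩
  refine ⟨fun v => (x (f (Sum.inl v)), x (f (Sum.inr v))), ?_⟩
  have := hx.1.comp f f.injective
  unfold GenericConf
  convert this using 1
  ext (v | v) <;> rfl

theorem generic_inj {V : Type} {p : V → ℝ × ℝ} (hp : GenericConf p) : Function.Injective p := by
  intro u v h
  have := hp.injective (a₁ := Sum.inl u) (a₂ := Sum.inl v) (by simp [h])
  simpa using this

theorem generic_det {V : Type} {p : V → ℝ × ℝ} (hp : GenericConf p) (u v w : V)
    (huv : u ≠ v) (huw : u ≠ w) (hvw : v ≠ w) :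
    ((p v).1 - (p u).1) * ((p w).2 - (p u).2) - ((p w).1 - (p u).1) * ((p v).2 - (p u).2) ≠ 0 := by
  classical
  intro h
  let X : V → MvPolynomial (V ⊕ V) ℚ := fun v => MvPolynomial.X (Sum.inl v)
  let Y : V → MvPolynomial (V ⊕ V) ℚ := fun v => MvPolynomial.X (Sum.inr v)
  have h0 : (X v - X u) * (Y w - Y u) - (X w - X u) * (Y v - Y u) = 0 := by
    apply (algebraicIndependent_iff.1 hp)
    simp only [X, Y, map_sub, map_mul, MvPolynomial.aeval_X, Sum.elim_inl, Sum.elim_inr]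
    exact h
  have h1 := congrArg (MvPolynomial.eval (Sum.elim (fun x => if x = v then (1:ℚ) else 0)
    (fun x => if x = w then (1:ℚ) else 0))) h0
  simp [X, Y, huv, huw, hvw, hvw.symm] at h1

abbrev LCol {V : Type} {G : SimpleGraph V} (E : PlaneEmb G) : Type :=
  V ⊕ ({F : E.Face // F ≠ E.outer} × Fin 3)

open Classical in
noncomputable def AL {V : Type} {G : SimpleGraph V} (E : PlaneEmb G) (F : E.Face) (i : Fin 3) :
    (LCol E → ℝ) →ₗ[ℝ] ℝ :=
  if h : F ≠ E.outer then LinearMap.proj (Sum.inr (⟨F, h⟩, i)) else 0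

noncomputable def Aval {V : Type} {G : SimpleGraph V} (E : PlaneEmb G) (p : V → ℝ × ℝ)
    (x : LCol E → ℝ) (F : E.Face) (v : V) : ℝ :=
  AL E F 0 x * (p v).1 + AL E F 1 x * (p v).2 + AL E F 2 x

def IsLift {V : Type} {G : SimpleGraph V} (E : PlaneEmb G) (p : V → ℝ × ℝ)
    (x : LCol E → ℝ) : Prop :=
  ∀ d : G.Dart, Aval E p x (E.angleFace d) d.fst = x (Sum.inl d.fst)

def Pt {V : Type} (p : V → ℝ × ℝ) (v : V) : Fin 3 → ℝ := ![(p v).1, (p v).2, 1]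

open Classical in
noncomputable def IM {V : Type} {G : SimpleGraph V} (E : PlaneEmb G) (p : V → ℝ × ℝ) :
    Matrix G.Dart (LCol E) ℝ := fun d c =>
  match c with
  | Sum.inl v => if d.fst = v then -1 else 0
  | Sum.inr (F, i) => if E.angleFace d = F.1 then Pt p d.fst i else 0

section
variable {V : Type} {G : SimpleGraph V} (E : PlaneEmb G) (p : V → ℝ × ℝ)

theorem IM_mulVec [Fintype V] [Fintype (LCol E)] (x : LCol E → ℝ) (d : G.Dart) :
    (IM E p).mulVec x d = Aval E p x (E.angleFace d) d.fst - x (Sum.inl d.fst) := by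
  classical
  have : Fintype {F : E.Face // F ≠ E.outer} := by
    have : Finite {F : E.Face // F ≠ E.outer} := by
      have h : Finite (LCol E) := inferInstance
      exact Finite.of_injective (fun F => (Sum.inr (F, 0) : LCol E)) (by
        intro a b hab; simpa using hab)
    exact Fintype.ofFinite _
  have e1 : (IM E p).mulVec x d = ∑ c : LCol E, IM E p d c * x c := rfl
  have e2 : (∑ c : LCol E, IM E p d c * x c) =
      @Finset.sum _ _ _ (@Finset.univ (LCol E) (instFintypeSum _ _)) (fun c => IM E p d c * x c) := by
    congr!
  rw [e1, e2, Fintype.sum_sum_type, Fintype.sum_prod_type]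
  have e3 : ∑ v, IM E p d (Sum.inl v) * x (Sum.inl v) = - x (Sum.inl d.fst) := by
    simp [IM]
  have e4 : ∑ F : {F : E.Face // F ≠ E.outer}, ∑ i : Fin 3,
      IM E p d (Sum.inr (F, i)) * x (Sum.inr (F, i)) = Aval E p x (E.angleFace d) d.fst := by
    simp only [Fin.sum_univ_three, IM, Pt, Aval, AL]
    by_cases h : E.angleFace d = E.outer
    · have : ∀ F : {F : E.Face // F ≠ E.outer}, E.outer ≠ F.1 := fun F => F.2.symm
      simp [h, this]
    · rw [Finset.sum_eq_single ⟨E.angleFace d, h⟩]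
      · simp [h]; ring
      · intro F _ hF
        have : E.angleFace d ≠ F.1 := fun h' => hF (Subtype.ext h'.symm)
        simp [this]
      · simp
  rw [e3, e4]; ring

theorem isLift_iff [Fintype V] [Fintype (LCol E)] (x : LCol E → ℝ) :
    IsLift E p x ↔ (IM E p).mulVec x = 0 := by
  constructor
  · intro h; ext d; rw [IM_mulVec, h d]; simp
  · intro h d
    have := congrFun h d
    rw [IM_mulVec] at this
    simp at this; linarith

theorem dartFace_rot (d : G.Dart) : E.dartFace (E.rot d) = E.dartFace d.symm := by
  apply Quotient.sound
  refine Equiv.Perm.SameCycle.symm ?_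
  refine ⟨1, ?_⟩
  simp [dartSymmPerm]

variable {E p}
variable {x : LCol E → ℝ}

theorem IsLift.inc1 (h : IsLift E p x) (d : G.Dart) :
    Aval E p x (E.dartFace d.symm) d.fst = x (Sum.inl d.fst) := h d

theorem IsLift.inc2 (h : IsLift E p x) (d : G.Dart) :
    Aval E p x (E.dartFace d) d.fst = x (Sum.inl d.fst) := by
  have := h.inc1 (E.rot.symm d)
  rw [← dartFace_rot] at this
  have h2 := E.rot_fst (E.rot.symm d)
  simp at this h2
  rw [← h2] at this
  exact this

theorem IsLift.inc3 (h : IsLift E p x) (d : G.Dart) :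
    Aval E p x (E.dartFace d) d.snd = x (Sum.inl d.snd) := by
  have := h.inc1 d.symm
  simpa using this

variable (E p) in
noncomputable def om (d : G.Dart) : (LCol E → ℝ) →ₗ[ℝ] ℝ :=
  (((p d.snd).1 - (p d.fst).1)^2 + ((p d.snd).2 - (p d.fst).2)^2)⁻¹ •
    (((p d.snd).1 - (p d.fst).1) • (AL E (E.dartFace d) 1 - AL E (E.dartFace d.symm) 1)
     - ((p d.snd).2 - (p d.fst).2) • (AL E (E.dartFace d) 0 - AL E (E.dartFace d.symm) 0))

theorem om_symm (d : G.Dart) (x : LCol E → ℝ) : om E p d.symm x = om E p d x := by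
  have e : ((p d.fst).1 - (p d.snd).1)^2 + ((p d.fst).2 - (p d.snd).2)^2 =
    ((p d.snd).1 - (p d.fst).1)^2 + ((p d.snd).2 - (p d.fst).2)^2 := by ring
  simp only [om, LinearMap.smul_apply, LinearMap.sub_apply, smul_eq_mul,
    SimpleGraph.Dart.symm_symm]
  have e1 : d.symm.fst = d.snd := rfl
  have e2 : d.symm.snd = d.fst := rfl
  rw [e1, e2, e]
  ring

theorem nsq_ne (hp : Function.Injective p) (d : G.Dart) :
    ((p d.snd).1 - (p d.fst).1)^2 + ((p d.snd).2 - (p d.fst).2)^2 ≠ 0 := by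
  intro h
  have h1 : (p d.snd).1 - (p d.fst).1 = 0 := by nlinarith [sq_nonneg ((p d.snd).1 - (p d.fst).1), sq_nonneg ((p d.snd).2 - (p d.fst).2)]
  have h2 : (p d.snd).2 - (p d.fst).2 = 0 := by nlinarith [sq_nonneg ((p d.snd).1 - (p d.fst).1), sq_nonneg ((p d.snd).2 - (p d.fst).2)]
  exact d.fst_ne_snd (hp (Prod.ext (by linarith) (by linarith)))

theorem IsLift.J (hp : Function.Injective p) (h : IsLift E p x) (d : G.Dart) :
    AL E (E.dartFace d) 0 x - AL E (E.dartFace d.symm) 0 x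
        = - (om E p d x * ((p d.snd).2 - (p d.fst).2)) ∧
    AL E (E.dartFace d) 1 x - AL E (E.dartFace d.symm) 1 x
        = om E p d x * ((p d.snd).1 - (p d.fst).1) := by
  have h1 := h.inc1 d
  have h2 := h.inc2 d
  have h3 := h.inc3 d
  have h4 := h.inc3 d.symm
  have h5 := h.inc2 d.symm
  have e1 : d.symm.fst = d.snd := rfl
  rw [e1] at h5
  have hn := nsq_ne hp d
  simp only [om, LinearMap.smul_apply, LinearMap.sub_apply, smul_eq_mul]
  simp only [Aval] at h1 h2 h3 h5
  set a0 := AL E (E.dartFace d) 0 x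
  set a1 := AL E (E.dartFace d) 1 x
  set b0 := AL E (E.dartFace d.symm) 0 x
  set b1 := AL E (E.dartFace d.symm) 1 x
  have key : (a0 - b0) * ((p d.snd).1 - (p d.fst).1)
      + (a1 - b1) * ((p d.snd).2 - (p d.fst).2) = 0 := by linear_combination h1 - h2 + h3 - h5
  constructor
  · field_simp
    linear_combination ((p d.snd).1 - (p d.fst).1) * key
  · field_simp
    linear_combination ((p d.snd).2 - (p d.fst).2) * key

theorem IsLift.om_zero (hp : Function.Injective p) (h : IsLift E p x) (d : G.Dart)
    (h0 : om E p d x = 0) (i : Fin 3) :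
    AL E (E.dartFace d) i x = AL E (E.dartFace d.symm) i x := by
  obtain ⟨j0, j1⟩ := h.J hp d
  rw [h0] at j0 j1
  have a0 : AL E (E.dartFace d) 0 x = AL E (E.dartFace d.symm) 0 x := by linarith
  have a1 : AL E (E.dartFace d) 1 x = AL E (E.dartFace d.symm) 1 x := by linarith
  have h1 := h.inc1 d
  have h2 := h.inc2 d
  simp only [Aval] at h1 h2
  rw [← a0, ← a1] at h1
  have a2 : AL E (E.dartFace d) 2 x = AL E (E.dartFace d.symm) 2 x := by linarith
  fin_cases i <;> assumption

theorem tele [Fintype G.Dart] (g : G.Dart → ℝ) (c : V → ℝ) :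
    ∑ d, (g d - g (E.rot d)) * c d.fst = 0 := by
  have : ∑ d, g (E.rot d) * c d.fst = ∑ d, g d * c d.fst := by
    rw [← Equiv.sum_comp E.rot (fun d => g d * c d.fst)]
    simp [E.rot_fst]
  simp [sub_mul, Finset.sum_sub_distrib, this]

theorem IsLift.eq1 [Fintype G.Dart] (hp : Function.Injective p) (h : IsLift E p x) (c : V → ℝ) :
    ∑ d : G.Dart, om E p d x * ((p d.snd).1 - (p d.fst).1) * c d.fst = 0 := by
  rw [← tele (E := E) (fun d => AL E (E.dartFace d) 1 x) c]
  apply Finset.sum_congr rfl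
  intro d _
  rw [dartFace_rot, (h.J hp d).2]

theorem IsLift.eq2 [Fintype G.Dart] (hp : Function.Injective p) (h : IsLift E p x) (c : V → ℝ) :
    ∑ d : G.Dart, om E p d x * ((p d.snd).2 - (p d.fst).2) * c d.fst = 0 := by
  rw [← neg_eq_zero, ← tele (E := E) (fun d => AL E (E.dartFace d) 0 x) c, ← Finset.sum_neg_distrib]
  apply Finset.sum_congr rfl
  intro d _
  rw [dartFace_rot, (h.J hp d).1]
  ring

theorem IsLift.work [Fintype G.Dart] (hp : Function.Injective p) (h : IsLift E p x)
    (q : V → ℝ × ℝ) :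
    ∑ d : G.Dart, om E p d x * dot2 (p d.fst - p d.snd) (q d.fst - q d.snd) = 0 := by
  have h1 := h.eq1 hp (fun v => (q v).1)
  have h2 := h.eq2 hp (fun v => (q v).2)
  have s1 := h1
  have s2 := h2
  rw [← Equiv.sum_comp (dartSymmPerm G)] at s1 s2
  have : ∑ d : G.Dart, om E p d x * dot2 (p d.fst - p d.snd) (q d.fst - q d.snd) =
      - (∑ d : G.Dart, om E p d x * ((p d.snd).1 - (p d.fst).1) * (q d.fst).1)
      - (∑ d : G.Dart, om E p d x * ((p d.snd).2 - (p d.fst).2) * (q d.fst).2)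
      - (∑ d : G.Dart, om E p (dartSymmPerm G d) x * ((p (dartSymmPerm G d).snd).1 -
          (p (dartSymmPerm G d).fst).1) * (q (dartSymmPerm G d).fst).1)
      - (∑ d : G.Dart, om E p (dartSymmPerm G d) x * ((p (dartSymmPerm G d).snd).2 -
          (p (dartSymmPerm G d).fst).2) * (q (dartSymmPerm G d).fst).2) := by
    rw [← Finset.sum_neg_distrib, ← Finset.sum_sub_distrib, ← Finset.sum_sub_distrib,
      ← Finset.sum_sub_distrib]
    apply Finset.sum_congr rfl
    intro d _
    have e0 : dartSymmPerm G d = d.symm := rfl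
    have e1 : d.symm.fst = d.snd := rfl
    have e2 : d.symm.snd = d.fst := rfl
    rw [e0, e1, e2, om_symm]
    simp only [dot2, Prod.fst_sub, Prod.snd_sub]
    ring
  rw [this, h1, h2, s1, s2]; simp

/-- a plane vanishing at three non-collinear points vanishes -/
theorem plane_zero (a0 a1 a2 : ℝ) (u v w : ℝ × ℝ)
    (hu : a0 * u.1 + a1 * u.2 + a2 = 0) (hv : a0 * v.1 + a1 * v.2 + a2 = 0)
    (hw : a0 * w.1 + a1 * w.2 + a2 = 0)
    (hd : (v.1 - u.1) * (w.2 - u.2) - (w.1 - u.1) * (v.2 - u.2) ≠ 0) :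
    a0 = 0 ∧ a1 = 0 ∧ a2 = 0 := by
  have h0 : a0 * ((v.1 - u.1) * (w.2 - u.2) - (w.1 - u.1) * (v.2 - u.2)) = 0 := by
    linear_combination (w.2 - u.2) * (hv - hu) - (v.2 - u.2) * (hw - hu)
  have h1 : a1 * ((v.1 - u.1) * (w.2 - u.2) - (w.1 - u.1) * (v.2 - u.2)) = 0 := by
    linear_combination (v.1 - u.1) * (hw - hu) - (w.1 - u.1) * (hv - hu)
  have h0' := (mul_eq_zero.1 h0).resolve_right hd
  have h1' := (mul_eq_zero.1 h1).resolve_right hd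
  refine ⟨h0', h1', ?_⟩
  rw [h0', h1'] at hu; linarith

theorem IsLift.face_zero [Fintype G.Dart] (hp : GenericConf p) (h : IsLift E p x)
    (hz : ∀ d : G.Dart, om E p d x ≠ 0 → x (Sum.inl d.fst) = 0) (d : G.Dart)
    (hd : om E p d x ≠ 0) (i : Fin 3) : AL E (E.dartFace d.symm) i x = 0 := by
  classical
  have hinj := generic_inj hp
  have hex : ∃ k : ℕ, om E p ((E.rot ^ (k + 1)) d) x ≠ 0 := by
    refine ⟨orderOf E.rot - 1, ?_⟩
    have : orderOf E.rot - 1 + 1 = orderOf E.rot := by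
      have := orderOf_pos E.rot; omega
    rw [this, pow_orderOf_eq_one]
    simpa using hd
  set k := Nat.find hex with hk
  have hk1 : om E p ((E.rot ^ (k + 1)) d) x ≠ 0 := Nat.find_spec hex
  have hk2 : ∀ j < k, om E p ((E.rot ^ (j + 1)) d) x = 0 := fun j hj => by
    have := Nat.find_min hex hj
    simpa using this
  have hface : ∀ j ≤ k, ∀ i, AL E (E.dartFace ((E.rot ^ (j + 1)) d)) i x
      = AL E (E.dartFace d.symm) i x := by
    intro j
    induction j with
    | zero => intro _ i; simp [dartFace_rot]
    | succ j ih =>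
      intro hj i
      rw [← ih (by omega) i, pow_succ', Equiv.Perm.mul_apply, dartFace_rot]
      exact (h.om_zero hinj _ (hk2 j (by omega)) i).symm
  have hfst : ∀ j : ℕ, ((E.rot ^ j) d).fst = d.fst := by
    intro j
    induction j with
    | zero => simp
    | succ j ih => rw [pow_succ', Equiv.Perm.mul_apply, E.rot_fst, ih]
  set d' := (E.rot ^ (k + 1)) d with hd'
  have hne : d' ≠ d := by
    intro heq
    -- all other darts at the vertex have zero stress
    have hall : ∀ n : ℕ, (E.rot ^ n) d ≠ d → om E p ((E.rot ^ n) d) x = 0 := by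
      intro n hn
      have hmul : ∀ m : ℕ, (E.rot ^ ((k + 1) * m)) d = d := by
        intro m
        induction m with
        | zero => simp
        | succ m ih => rw [Nat.mul_succ, pow_add, Equiv.Perm.mul_apply, ← hd', heq, ih]
      have hmod : (E.rot ^ n) d = (E.rot ^ (n % (k + 1))) d := by
        conv_lhs => rw [← Nat.mod_add_div n (k + 1), pow_add, Equiv.Perm.mul_apply, hmul]
      rw [hmod] at hn ⊢
      rcases Nat.eq_zero_or_pos (n % (k + 1)) with h0 | h0
      · rw [h0] at hn; simp at hn
      · obtain ⟨j, hj⟩ : ∃ j, n % (k + 1) = j + 1 := ⟨n % (k + 1) - 1, by omega⟩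
        rw [hj]
        apply hk2
        have := Nat.mod_lt n (show k + 1 > 0 by omega)
        omega
    have hsingle : ∀ (f : G.Dart → ℝ),
        ∑ b : G.Dart, om E p b x * f b * (if b.fst = d.fst then 1 else 0)
          = om E p d x * f d := by
      intro f
      rw [Finset.sum_eq_single d]
      · simp
      · intro b _ hb
        by_cases hbf : b.fst = d.fst
        · obtain ⟨n, rfl⟩ := E.rot_vertex d b hbf.symm
          rw [hall n hb]; simp
        · simp [hbf]
      · simp
    have q1 := h.eq1 hinj (fun v => if v = d.fst then 1 else 0)
    have q2 := h.eq2 hinj (fun v => if v = d.fst then 1 else 0)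
    rw [hsingle (fun b => (p b.snd).1 - (p b.fst).1)] at q1
    rw [hsingle (fun b => (p b.snd).2 - (p b.fst).2)] at q2
    have q1' := (mul_eq_zero.1 q1).resolve_left hd
    have q2' := (mul_eq_zero.1 q2).resolve_left hd
    exact nsq_ne hinj d (by rw [q1', q2']; simp)
  have hf' : d'.fst = d.fst := hfst _
  have hs' : d.snd ≠ d'.snd := by
    intro hs
    exact hne (SimpleGraph.Dart.ext _ _ (Prod.ext hf' hs.symm))
  have z1 : x (Sum.inl d.fst) = 0 := hz d hd
  have z2 : x (Sum.inl d.snd) = 0 := hz d.symm (by rwa [om_symm])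
  have z3 : x (Sum.inl d'.snd) = 0 := hz d'.symm (by rwa [om_symm])
  have i1 := h.inc1 d
  have i2 := h.inc2 d.symm
  have i3 := h.inc3 d'
  have e1 : d.symm.fst = d.snd := rfl
  rw [e1, z2] at i2
  rw [z1] at i1
  rw [z3] at i3
  have hfk : ∀ i, AL E (E.dartFace d') i x = AL E (E.dartFace d.symm) i x := hface k le_rfl
  simp only [Aval, hfk] at i1 i2 i3
  have hdet := generic_det hp d.fst d.snd d'.snd d.fst_ne_snd (hf' ▸ d'.fst_ne_snd) hs'
  obtain ⟨r0, r1, r2⟩ := plane_zero _ _ _ _ _ _ i1 i2 i3 hdet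
  fin_cases i <;> assumption

theorem dart_const {X : Type*} (c : G.Dart → X) (h1 : ∀ d, c (E.rot d) = c d)
    (h2 : ∀ d, c d.symm = c d) (d d' : G.Dart) : c d = c d' := by
  have hv : ∀ a b : G.Dart, a.fst = b.fst → c a = c b := by
    intro a b hab
    obtain ⟨n, rfl⟩ := E.rot_vertex a b hab
    clear hab
    induction n with
    | zero => simp
    | succ n ih => rw [pow_succ', Equiv.Perm.mul_apply, h1, ih]
  obtain ⟨w⟩ := E.connected.preconnected d.fst d'.fst
  have : ∀ (u v : V) (w : G.Walk u v) (a b : G.Dart), a.fst = u → b.fst = v → c a = c b := by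
    intro u v w
    induction w with
    | nil => intro a b ha hb; exact hv a b (ha.trans hb.symm)
    | cons hadj w ih =>
      intro a b ha hb
      let m : G.Dart := ⟨(_, _), hadj⟩
      rw [hv a m ha, ← h2 m]
      exact ih m.symm b rfl hb
  exact this _ _ w d d' rfl rfl

theorem exists_dart (E : PlaneEmb G) (v : V) : ∃ d : G.Dart, d.fst = v := by
  obtain ⟨d, -⟩ := Quotient.exists_rep E.outer
  have : Nontrivial V := ⟨d.fst, d.snd, d.fst_ne_snd⟩
  obtain ⟨u, hu⟩ := E.connected.preconnected.exists_adj_of_nontrivial v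
  exact ⟨⟨(v, u), hu⟩, rfl⟩

theorem IsLift.zero_of_om (hp : Function.Injective p) (h : IsLift E p x)
    (h0 : ∀ d, om E p d x = 0) : x = 0 := by
  have hA : ∀ d i, AL E (E.dartFace d) i x = 0 := by
    intro d i
    obtain ⟨d0, hd0⟩ := Quotient.exists_rep E.outer
    have hd0' : E.dartFace d0 = E.outer := hd0
    rw [dart_const (E := E) (fun d => AL E (E.dartFace d) i x) (fun d => by
      rw [dartFace_rot]; exact (h.om_zero hp d (h0 d) i).symm)
      (fun d => (h.om_zero hp d (h0 d) i).symm) d d0, hd0']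
    simp [AL]
  ext c
  rcases c with v | ⟨⟨F, hF⟩, i⟩
  · obtain ⟨d, rfl⟩ := exists_dart E v
    rw [← h.inc2 d]
    simp [Aval, hA]
  · obtain ⟨d, rfl⟩ := Quotient.exists_rep F
    have := hA d i
    have e : E.dartFace d = (Quotient.mk (faceSetoid (E.rot * dartSymmPerm G)) d) := rfl
    rw [e] at this
    simpa [AL, hF] using this

theorem IsLift.zero_of_cond [Fintype G.Dart] (hp : GenericConf p) (h : IsLift E p x)
    (hz : ∀ d : G.Dart, om E p d x ≠ 0 → x (Sum.inl d.fst) = 0) : x = 0 := by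
  have hinj := generic_inj hp
  apply h.zero_of_om hinj
  intro d
  by_contra hd
  have h1 := h.face_zero hp hz d hd
  have h2 := h.face_zero hp hz d.symm (by rwa [om_symm])
  rw [SimpleGraph.Dart.symm_symm] at h2
  obtain ⟨j0, j1⟩ := h.J hinj d
  rw [h1, h2] at j0 j1
  apply hd
  have hn := nsq_ne hinj d
  have : om E p d x * (((p d.snd).1 - (p d.fst).1)^2 + ((p d.snd).2 - (p d.fst).2)^2) = 0 := by
    linear_combination - ((p d.snd).1 - (p d.fst).1) * j1 + ((p d.snd).2 - (p d.fst).2) * j0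
  exact (mul_eq_zero.1 this).resolve_right hn

end

section
variable {V : Type} {G : SimpleGraph V}

/-- rigidity map for a family of darts -/
def Rmap (p : V → ℝ × ℝ) {η : Type} (o : η → G.Dart) : (V → ℝ × ℝ) →ₗ[ℝ] (η → ℝ) where
  toFun q := fun e => dot2 (p (o e).fst - p (o e).snd) (q (o e).fst - q (o e).snd)
  map_add' q q' := by ext e; simp [dot2]; ring
  map_smul' c q := by ext e; simp [dot2]; ring

noncomputable def Str (p : V → ℝ × ℝ) {η : Type} [Fintype η] (o : η → G.Dart) :
    Submodule ℝ (η → ℝ) := by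
  classical
  exact LinearMap.ker ((Rmap p o).dualMap ∘ₗ (dotProductEquiv ℝ η).toLinearMap)

theorem mem_Str (p : V → ℝ × ℝ) {η : Type} [Fintype η] (o : η → G.Dart) (w : η → ℝ) :
    w ∈ Str p o ↔ ∀ q : V → ℝ × ℝ, ∑ e, w e * Rmap p o q e = 0 := by
  classical
  unfold Str
  rw [LinearMap.mem_ker, LinearMap.ext_iff]
  apply forall_congr'
  intro q
  simp [dotProductEquiv, dotProduct]

theorem finrank_Str [Fintype V] (p : V → ℝ × ℝ) {η : Type} [Fintype η] (o : η → G.Dart) :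
    Module.finrank ℝ (Str p o) + 2 * Fintype.card V
      = Fintype.card η + Module.finrank ℝ (LinearMap.ker (Rmap p o)) := by
  classical
  have h1 := LinearMap.finrank_range_add_finrank_ker
    ((Rmap p o).dualMap ∘ₗ (dotProductEquiv ℝ η).toLinearMap)
  have h2 : LinearMap.range ((Rmap p o).dualMap ∘ₗ (dotProductEquiv ℝ η).toLinearMap)
      = LinearMap.range (Rmap p o).dualMap := by
    rw [LinearMap.range_comp, LinearEquiv.range, Submodule.map_top]
  rw [h2, LinearMap.finrank_range_dualMap_eq_finrank_range] at h1
  have h3 := LinearMap.finrank_range_add_finrank_ker (Rmap p o)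
  have h4 : Module.finrank ℝ (V → ℝ × ℝ) = 2 * Fintype.card V := by
    rw [Module.finrank_pi_fintype]; simp [mul_comm]
  have h5 : Module.finrank ℝ (η → ℝ) = Fintype.card η := by simp
  have h6 : Module.finrank ℝ (Str p o) = Module.finrank ℝ (LinearMap.ker
    ((Rmap p o).dualMap ∘ₗ (dotProductEquiv ℝ η).toLinearMap)) := rfl
  omega

theorem ker_le [Fintype V] (p : V → ℝ × ℝ) {η : Type} (o : η → G.Dart)
    (ho : ∀ d : G.Dart, ∃ e, o e = d ∨ o e = d.symm) (hr : InfRigid G p) :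
    Module.finrank ℝ (LinearMap.ker (Rmap p o)) ≤ 3 := by
  let T : ℝ × ℝ × ℝ →ₗ[ℝ] (V → ℝ × ℝ) :=
    { toFun := fun a v => a.1 • rot90 (p v) + a.2
      map_add' := by intro a b; ext v <;> simp [rot90] <;> ring
      map_smul' := by intro c a; ext v <;> simp [rot90] <;> ring }
  have hle : LinearMap.ker (Rmap p o) ≤ LinearMap.range T := by
    intro q hq
    have hm : IsInfMotion G p q := by
      intro u v huv
      obtain ⟨e, he⟩ := ho ⟨(u, v), huv⟩
      have := congrFun (LinearMap.mem_ker.1 hq) e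
      simp only [Rmap, LinearMap.coe_mk, AddHom.coe_mk, Pi.zero_apply] at this
      rcases he with he | he
      · rw [he] at this; exact this
      · rw [he] at this
        rw [← this]
        simp [dot2]; ring
    obtain ⟨a, t, h⟩ := hr q hm
    exact ⟨(a, t), by ext1 v; exact (h v).symm⟩
  have h1 := Submodule.finrank_mono hle
  have h2 := LinearMap.finrank_range_le T
  have h3 : Module.finrank ℝ (ℝ × ℝ × ℝ) = 3 := by simp
  omega

theorem ker_ge [Fintype V] (p : V → ℝ × ℝ) (hp : Function.Injective p) {η : Type}
    (o : η → G.Dart) (S : Finset V) (hS : 2 ≤ S.card)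
    (ho : ∀ e, (o e).fst ∈ S ∧ (o e).snd ∈ S) :
    2 * Fintype.card V + 3 ≤ Module.finrank ℝ (LinearMap.ker (Rmap p o)) + 2 * S.card := by
  classical
  let T : ((ℝ × ℝ × ℝ) × ({v // v ∉ S} → ℝ × ℝ)) →ₗ[ℝ] (V → ℝ × ℝ) :=
    { toFun := fun a v => if h : v ∉ S then a.2 ⟨v, h⟩ else a.1.1 • rot90 (p v) + a.1.2
      map_add' := by
        intro a b; ext v <;> by_cases h : v ∈ S <;> simp [rot90, h] <;> ring
      map_smul' := by
        intro c a; ext v <;> by_cases h : v ∈ S <;> simp [rot90, h] <;> ring }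
  have hT : Function.Injective T := by
    rw [← LinearMap.ker_eq_bot, eq_bot_iff]
    rintro ⟨⟨a, t⟩, g⟩ h
    rw [LinearMap.mem_ker] at h
    have hv : ∀ v, T ((a, t), g) v = 0 := fun v => congrFun h v
    obtain ⟨u, hu, v, hvS, huv⟩ := Finset.one_lt_card.1 (show 1 < S.card by omega)
    have e1 := hv u
    have e2 := hv v
    simp [T, hu, hvS, rot90, Prod.ext_iff] at e1 e2
    obtain ⟨e11, e12⟩ := e1
    obtain ⟨e21, e22⟩ := e2
    have ha : a = 0 := by
      by_contra ha
      apply huv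
      apply hp
      apply Prod.ext
      · apply mul_left_cancel₀ ha; linarith
      · apply mul_left_cancel₀ ha; linarith
    subst ha
    have ht : t = 0 := by
      apply Prod.ext <;> simp at * <;> assumption
    have hg : g = 0 := by
      ext1 w
      have := hv w.1
      simpa [T, w.2] using this
    simp [ht, hg]
  have hle : LinearMap.range T ≤ LinearMap.ker (Rmap p o) := by
    rintro _ ⟨a, rfl⟩
    rw [LinearMap.mem_ker]
    ext e
    obtain ⟨h1, h2⟩ := ho e
    simp [Rmap, T, h1, h2, dot2, rot90]
    ring
  have h1 := Submodule.finrank_mono hle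
  rw [LinearMap.finrank_range_of_inj hT] at h1
  have h2 : Module.finrank ℝ ((ℝ × ℝ × ℝ) × ({v // v ∉ S} → ℝ × ℝ))
      = 3 + 2 * (Fintype.card V - S.card) := by
    rw [Module.finrank_prod, Module.finrank_pi_fintype]
    simp [Fintype.card_subtype_compl, mul_comm]
  have h3 : S.card ≤ Fintype.card V := Finset.card_le_univ S
  omega

theorem sum_darts [Fintype G.Dart] [Fintype G.edgeSet] (o : G.edgeSet → G.Dart)
    (ho : ∀ e, (o e).edge = e) (g : G.Dart → ℝ) (hg : ∀ d, g d.symm = g d) :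
    ∑ d, g d = 2 * ∑ e, g (o e) := by
  classical
  rw [← Finset.sum_fiberwise Finset.univ (fun d : G.Dart => (⟨d.edge, d.edge_mem⟩ : G.edgeSet)),
    Finset.mul_sum]
  apply Finset.sum_congr rfl
  intro e _
  have : Finset.univ.filter (fun d : G.Dart => (⟨d.edge, d.edge_mem⟩ : G.edgeSet) = e)
      = {o e, (o e).symm} := by
    ext d
    simp only [Finset.mem_filter, Finset.mem_univ, true_and, Finset.mem_insert,
      Finset.mem_singleton, Subtype.ext_iff]
    rw [← ho e, SimpleGraph.dart_edge_eq_iff]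
  rw [this, Finset.sum_pair (o e).symm_ne.symm, hg]
  ring
end

theorem main_aux {V : Type} [Fintype V] [DecidableEq V] (G : SimpleGraph V)
    (E : PlaneEmb G) [Fintype G.Dart] [Fintype G.edgeSet] [Fintype E.Face]
    (p : V → ℝ × ℝ) (hp : GenericConf p) (hr : InfRigid G p) :
    ∃ big : G.Dart → Prop, IsCPTLabelling E big ∧ GenLaman G big := by
  classical
  have hinj := generic_inj hp
  have hoex : ∀ e : G.edgeSet, ∃ d : G.Dart, d.edge = e := by
    rintro ⟨e, he⟩
    induction e using Sym2.ind with
    | _ u v => exact ⟨⟨(u, v), he⟩, rfl⟩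
  choose o ho using hoex
  have ho' : ∀ d : G.Dart, o ⟨d.edge, d.edge_mem⟩ = d ∨ o ⟨d.edge, d.edge_mem⟩ = d.symm := by
    intro d
    have := ho ⟨d.edge, d.edge_mem⟩
    exact (SimpleGraph.dart_edge_eq_iff _ _).1 this
  have homd : ∀ d : G.Dart, om E p (o ⟨d.edge, d.edge_mem⟩) = om E p d := by
    intro d
    rcases ho' d with h | h
    · rw [h]
    · rw [h]; exact LinearMap.ext (fun x => om_symm d x)
  -- counts
  have hD : Fintype.card G.Dart = 2 * Fintype.card G.edgeSet := by
    have := sum_darts o ho (fun _ => 1) (fun _ => rfl)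
    simp only [Finset.sum_const, Finset.card_univ, nsmul_eq_mul, mul_one] at this
    exact_mod_cast this
  have heul : Fintype.card V + Fintype.card E.Face = Fintype.card G.edgeSet + 2 := by
    rw [← Nat.card_eq_fintype_card (α := V), ← Nat.card_eq_fintype_card (α := E.Face),
      ← Nat.card_eq_fintype_card (α := G.edgeSet)]
    exact E.euler
  have hF' : Fintype.card {F : E.Face // F ≠ E.outer} + 1 = Fintype.card E.Face := by
    have h1 := Fintype.card_subtype_compl (fun F : E.Face => F = E.outer)
    have h2 : 0 < Fintype.card E.Face := Fintype.card_pos_iff.2 ⟨E.outer⟩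
    rw [Fintype.card_subtype_eq] at h1
    have h3 : Fintype.card {F : E.Face // F ≠ E.outer} = Fintype.card {F : E.Face // ¬ F = E.outer} := rfl
    omega
  have hC : Fintype.card (LCol E) =
      Fintype.card V + Fintype.card {F : E.Face // F ≠ E.outer} * 3 := by
    simp only [LCol, Fintype.card_sum, Fintype.card_prod, Fintype.card_fin]
  -- the lifting space
  let W : Submodule ℝ (LCol E → ℝ) := LinearMap.ker (IM E p).mulVecLin
  have hW : ∀ x : LCol E → ℝ, x ∈ W ↔ IsLift E p x := by
    intro x
    rw [isLift_iff, LinearMap.mem_ker, Matrix.mulVecLin_apply]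
  have hWdim : Fintype.card (LCol E) ≤ Module.finrank ℝ W + Fintype.card G.Dart := by
    have h1 := LinearMap.finrank_range_add_finrank_ker (IM E p).mulVecLin
    have h2 := Submodule.finrank_le (LinearMap.range (IM E p).mulVecLin)
    rw [Module.finrank_fintype_fun_eq_card] at h1 h2
    have h3 : Module.finrank ℝ W = Module.finrank ℝ (LinearMap.ker (IM E p).mulVecLin) := rfl
    omega
  let Om : W →ₗ[ℝ] (G.edgeSet → ℝ) := LinearMap.pi (fun e => (om E p (o e)).comp W.subtype)
  have hOm : ∀ (w : W) (d : G.Dart), Om w ⟨d.edge, d.edge_mem⟩ = om E p d w := by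
    intro w d
    simp only [Om, LinearMap.pi_apply, LinearMap.comp_apply, homd]
    rfl
  have hOminj : Function.Injective Om := by
    rw [← LinearMap.ker_eq_bot, eq_bot_iff]
    intro w hw
    rw [LinearMap.mem_ker] at hw
    have := ((hW w.1).1 w.2).zero_of_om hinj (fun d => by rw [← hOm w d, hw]; rfl)
    exact Subtype.ext this
  have hOmle : LinearMap.range Om ≤ Str p o := by
    rintro _ ⟨w, rfl⟩
    rw [mem_Str]
    intro q
    have h1 := ((hW w.1).1 w.2).work hinj q
    rw [sum_darts o ho _ (by
      intro d
      have e1 : d.symm.fst = d.snd := rfl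
      have e2 : d.symm.snd = d.fst := rfl
      simp only [om_symm, e1, e2, dot2, Prod.fst_sub, Prod.snd_sub]
      ring)] at h1
    have h2 : ∑ e, Om w e * Rmap p o q e = ∑ e, om E p (o e) w *
        dot2 (p (o e).fst - p (o e).snd) (q (o e).fst - q (o e).snd) := rfl
    rw [h2]; linarith
  have hs1 := finrank_Str p o
  have hs2 := ker_le p o (fun d => ⟨_, ho' d⟩) hr
  have hs3 := Submodule.finrank_mono hOmle
  rw [LinearMap.finrank_range_of_inj hOminj] at hs3
  have hrange : LinearMap.range Om = Str p o := by
    apply Submodule.eq_of_le_of_finrank_le hOmle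
    rw [LinearMap.finrank_range_of_inj hOminj]
    omega
  -- matroid intersection
  obtain ⟨I, hIc, hI1, hI2⟩ := linear_inter (W := W)
    (fun d : G.Dart => (LinearMap.proj (Sum.inl d.fst : LCol E)).comp W.subtype)
    (fun d : G.Dart => (om E p d).comp W.subtype) (by
      intro A w h1 h2
      apply Subtype.ext
      apply ((hW w.1).1 w.2).zero_of_cond hp
      intro d hd
      have hdA : d ∈ A := by
        by_contra hdA
        exact hd (h2 d hdA)
      exact h1 d hdA)
  let X : Finset V := I.image (fun d => d.fst)
  have hX : ∀ x : LCol E → ℝ, IsLift E p x → (∀ v ∈ X, x (Sum.inl v) = 0) → x = 0 := by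
    intro x hx h
    have := hI1 ⟨x, (hW x).2 hx⟩ (fun d hd => h d.fst (Finset.mem_image_of_mem _ hd))
    exact congrArg Subtype.val this
  have hXc : X.card = I.card := by
    apply le_antisymm Finset.card_image_le
    rw [hIc]
    let Z : W →ₗ[ℝ] (X → ℝ) :=
      LinearMap.pi (fun v => (LinearMap.proj (Sum.inl v.1 : LCol E)).comp W.subtype)
    have hZ : Function.Injective Z := by
      rw [← LinearMap.ker_eq_bot, eq_bot_iff]
      intro w hw
      rw [LinearMap.mem_ker] at hw
      exact Subtype.ext (hX w.1 ((hW w.1).1 w.2) (fun v hv => congrFun hw ⟨v, hv⟩))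
    have := LinearMap.finrank_le_finrank_of_injective hZ
    rw [Module.finrank_fintype_fun_eq_card, Fintype.card_coe] at this
    exact this
  have hfinj : Set.InjOn (fun d : G.Dart => d.fst) (I : Set G.Dart) := Finset.card_image_iff.1 hXc
  -- the labelling
  obtain ⟨τ, hτ⟩ := matching_lemma (IM E p) (X.image (Sum.inl : V → LCol E)) (by
      intro x hx h
      exact hX x ((isLift_iff E p x).2 hx) (fun v hv => h _ (Finset.mem_image_of_mem _ hv))) (by
      rw [Finset.card_image_of_injective _ Sum.inl_injective, hXc, hIc]
      omega)
  have t1 : ∀ d v, (τ d).1 = Sum.inl v → d.fst = v := by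
    intro d v h
    have := hτ d
    rw [h] at this
    by_contra hne
    simp [IM, hne] at this
  have t2 : ∀ d F i, (τ d).1 = Sum.inr (F, i) → E.angleFace d = F.1 := by
    intro d F i h
    have := hτ d
    rw [h] at this
    by_contra hne
    simp [IM, hne] at this
  let big : G.Dart → Prop := fun d => ∃ v, (τ d).1 = Sum.inl v
  have hpt : ∀ v, PointedVx big v ↔ v ∉ X := by
    intro v
    constructor
    · rintro ⟨d, ⟨u, hu⟩, rfl⟩ hv
      have := t1 d u hu
      apply (τ d).2
      rw [hu, ← this]
      exact Finset.mem_image_of_mem _ hv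
    · intro hv
      have hc : (Sum.inl v : LCol E) ∉ X.image (Sum.inl : V → LCol E) := by
        simpa using hv
      have e : (τ (τ.symm ⟨Sum.inl v, hc⟩)).1 = Sum.inl v := by simp
      exact ⟨τ.symm ⟨Sum.inl v, hc⟩, ⟨v, e⟩, t1 _ _ e⟩
  refine ⟨big, ⟨?_, ?_, ?_⟩, ?_⟩
  · intro F hF
    have hc : ∀ i : Fin 3, (Sum.inr (⟨F, hF⟩, i) : LCol E) ∉ X.image (Sum.inl : V → LCol E) := by
      intro i; simp
    let f : Fin 3 → {d : G.Dart | E.angleFace d = F ∧ ¬ big d} := fun i =>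
      ⟨τ.symm ⟨Sum.inr (⟨F, hF⟩, i), hc i⟩, by
        have e : (τ (τ.symm ⟨Sum.inr (⟨F, hF⟩, i), hc i⟩)).1 = Sum.inr (⟨F, hF⟩, i) := by simp
        refine ⟨t2 _ _ _ e, ?_⟩
        rintro ⟨v, hv⟩
        rw [e] at hv
        simp at hv⟩
    have hf : Function.Bijective f := by
      constructor
      · intro i j hij
        have := congrArg Subtype.val hij
        simpa [f] using this
      · rintro ⟨d, hd, hb⟩
        rcases hτd : (τ d).1 with v | ⟨F', i⟩
        · exact absurd ⟨v, hτd⟩ hb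
        · refine ⟨i, Subtype.ext ?_⟩
          have h2 := t2 _ _ _ hτd
          have h3 : F' = ⟨F, hF⟩ := Subtype.ext (h2.symm.trans hd)
          subst h3
          simp only [f]
          rw [Equiv.symm_apply_eq]
          exact Subtype.ext hτd.symm
    rw [← Nat.card_congr (Equiv.ofBijective f hf)]
    simp
  · intro d hd
    rcases hτd : (τ d).1 with v | ⟨F', i⟩
    · exact ⟨v, hτd⟩
    · exact absurd ((t2 _ _ _ hτd).symm.trans hd) F'.2
  · rintro d d' ⟨v, hv⟩ ⟨v', hv'⟩ hdd
    have h1 := t1 _ _ hv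
    have h2 := t1 _ _ hv'
    apply τ.injective
    apply Subtype.ext
    rw [hv, hv', ← h1, ← h2, hdd]
  · -- generalized Laman
    intro S hS
    let S' : Finset V := S.toFinset
    have hS'c : S'.card = Nat.card S := by
      rw [Nat.card_eq_fintype_card, Set.toFinset_card]
    let H : Type := {e : G.edgeSet // (o e).fst ∈ S' ∧ (o e).snd ∈ S'}
    let oH : H → G.Dart := fun e => o e.1
    have hg1 := ker_ge p hinj oH S' (by omega) (fun e => e.2)
    have hg2 := finrank_Str p oH
    -- edges of the induced graph
    have hedge : Nat.card (G.induce S).edgeSet ≤ Fintype.card H := by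
      rw [← Nat.card_eq_fintype_card]
      have hmE : ∀ e : (G.induce S).edgeSet, e.1.map Subtype.val ∈ G.edgeSet := by
        rintro ⟨e, he⟩
        induction e using Sym2.ind with
        | _ u v => simpa using he
      have hmem : ∀ e : (G.induce S).edgeSet, ∀ v ∈ e.1.map Subtype.val, v ∈ S' := by
        intro e v hv
        rw [Sym2.mem_map] at hv
        obtain ⟨a, _, rfl⟩ := hv
        simp [S']
      let g : (G.induce S).edgeSet → H := fun e =>
        ⟨⟨e.1.map Subtype.val, hmE e⟩, by
          have h1 : (o ⟨e.1.map Subtype.val, hmE e⟩).edge = e.1.map Subtype.val := ho _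
          constructor
          · apply hmem e
            have h2 : (o ⟨e.1.map Subtype.val, hmE e⟩).fst ∈
              (o ⟨e.1.map Subtype.val, hmE e⟩).edge := Sym2.mem_mk_left _ _
            rw [h1] at h2
            exact h2
          · apply hmem e
            have h2 : (o ⟨e.1.map Subtype.val, hmE e⟩).snd ∈
              (o ⟨e.1.map Subtype.val, hmE e⟩).edge := Sym2.mem_mk_right _ _
            rw [h1] at h2
            exact h2⟩
      apply Nat.card_le_card_of_injective g
      intro a b hab
      have h1 : a.1.map Subtype.val = b.1.map Subtype.val :=
        congrArg (fun e : H => (e.1.1 : Sym2 V)) hab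
      exact Subtype.ext (Sym2.map.injective Subtype.val_injective h1)
    -- stresses on S are determined by I
    let IH : Finset G.Dart := I.filter (fun d => d.fst ∈ S' ∧ d.snd ∈ S')
    let ext : (H → ℝ) →ₗ[ℝ] (G.edgeSet → ℝ) :=
      { toFun := fun s e => if h : (o e).fst ∈ S' ∧ (o e).snd ∈ S' then s ⟨e, h⟩ else 0
        map_add' := by intro a b; ext e; by_cases h : (o e).fst ∈ S' ∧ (o e).snd ∈ S' <;> simp [h]
        map_smul' := by intro a b; ext e; by_cases h : (o e).fst ∈ S' ∧ (o e).snd ∈ S' <;> simp [h] }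
    have hext1 : ∀ s (e : H), ext s e.1 = s e := by
      intro s e
      simp only [ext, LinearMap.coe_mk, AddHom.coe_mk]
      rw [dif_pos e.2]
    have hext2 : ∀ s (e : G.edgeSet), ¬ ((o e).fst ∈ S' ∧ (o e).snd ∈ S') → ext s e = 0 := by
      intro s e h
      simp only [ext, LinearMap.coe_mk, AddHom.coe_mk]
      rw [dif_neg h]
    have hextStr : ∀ s ∈ Str p oH, ext s ∈ Str p o := by
      intro s hs
      rw [mem_Str] at hs ⊢
      intro q
      rw [← hs q]
      have key : ∀ e : H, s e * Rmap p oH q e = ext s e.1 * Rmap p o q e.1 := by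
        intro e
        rw [hext1]
        rfl
      rw [Finset.sum_congr rfl (fun e _ => key e)]
      rw [← Finset.sum_subtype (Finset.univ.filter (fun e => (o e).fst ∈ S' ∧ (o e).snd ∈ S'))
        (by simp) (fun e => ext s e * Rmap p o q e), Finset.sum_filter]
      apply Finset.sum_congr rfl
      intro e _
      by_cases h : (o e).fst ∈ S' ∧ (o e).snd ∈ S'
      · rw [if_pos h]
      · rw [if_neg h, hext2 s e h, zero_mul]
    let Θ : Str p oH →ₗ[ℝ] (IH → ℝ) :=
      (LinearMap.pi (fun d : IH => (LinearMap.proj (⟨d.1.edge, d.1.edge_mem⟩ : G.edgeSet)).comp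
        (ext.comp (Str p oH).subtype)))
    have hΘ : Function.Injective Θ := by
      rw [← LinearMap.ker_eq_bot, eq_bot_iff]
      rintro ⟨s, hs⟩ h0
      rw [LinearMap.mem_ker] at h0
      have h1 := hextStr s hs
      rw [← hrange] at h1
      obtain ⟨w, hw⟩ := h1
      have hw0 : w = 0 := by
        apply hI2
        intro d hd
        change om E p d w = 0
        rw [← hOm w d, hw]
        by_cases hdS : d.fst ∈ S' ∧ d.snd ∈ S'
        · exact congrFun h0 ⟨d, Finset.mem_filter.2 ⟨hd, hdS⟩⟩
        · apply hext2
          rcases ho' d with h | h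
          · rw [h]; exact hdS
          · rw [h]; exact fun h' => hdS ⟨h'.2, h'.1⟩
      rw [hw0, map_zero] at hw
      apply Subtype.ext
      ext e
      change s e = 0
      rw [← hext1 s e, ← hw]
      rfl
    have hΘc := LinearMap.finrank_le_finrank_of_injective hΘ
    rw [Module.finrank_fintype_fun_eq_card, Fintype.card_coe] at hΘc
    have hIHc : IH.card ≤ (S'.filter (fun v => v ∈ X)).card := by
      apply Finset.card_le_card_of_injOn (fun d => d.fst)
      · intro d hd
        have hd' := Finset.mem_filter.1 hd
        exact Finset.mem_filter.2 ⟨hd'.2.1, Finset.mem_image_of_mem _ hd'.1⟩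
      · exact hfinj.mono (fun d hd => (Finset.mem_filter.1 hd).1)
    have c1 : Nat.card {v ∈ S | ¬ PointedVx big v} = (S'.filter (fun v => v ∈ X)).card := by
      have : {v ∈ S | ¬ PointedVx big v} = ((S'.filter (fun v => v ∈ X) : Finset V) : Set V) := by
        ext v; simp [S', hpt]
      rw [this, Nat.card_coe_set_eq, Set.ncard_coe_finset]
    have c2 : Nat.card {v ∈ S | PointedVx big v} = (S'.filter (fun v => v ∉ X)).card := by
      have : {v ∈ S | PointedVx big v} = ((S'.filter (fun v => v ∉ X) : Finset V) : Set V) := by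
        ext v; simp [S', hpt]
      rw [this, Nat.card_coe_set_eq, Set.ncard_coe_finset]
    have c3 := Finset.card_filter_add_card_filter_not (s := S') (fun v => v ∈ X)
    rw [c1, c2]
    omega

/-- **Theorem 8.** The angles of a generically rigid plane graph can be labelled big/small so
that the labelling is a CPT-labelling satisfying the generalized Laman condition. -/
theorem genRigid_plane_graph_has_genLaman_cpt_labelling
    {V : Type} [Fintype V] [DecidableEq V] (G : SimpleGraph V)
    (E : PlaneEmb G) (hrig : GenRigid G) :
    ∃ big : G.Dart → Prop, IsCPTLabelling E big ∧ GenLaman G big := by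
  classical
  obtain ⟨p, hp⟩ := exists_generic V
  haveI : Fintype G.Dart := Fintype.ofFinite _
  haveI : Fintype G.edgeSet := Fintype.ofFinite _
  haveI : Finite E.Face := Quotient.finite _
  haveI : Fintype E.Face := Fintype.ofFinite _
  exact main_aux G E p hp (hrig p hp)
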